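/- Let N ≥ 1 be an integer, σ ∈ (0,2), and let g : ℝ^N → ℝ be a C² function with bounded second derivatives. Then there exists a constant C > 0, depending only on N and σ, such that for every x ∈ ℝ^N, every R > 0 and every y > 0, the principal value lim_{ε→0⁺} ∫_{{ξ : ε < |ξ−x| < R}} (g(ξ) − g(x)) (K_0(x,ξ) − K_y(x,ξ)) dξ exists and its absolute value is at most C · (sup |D²g|) · y^{2−σ}. -/

import Mathlib

open MeasureTheory Filter Set

/-- The difference `K_0 - K_y` of the kernels of homogeneity `a`, as a function of the distance. -/
noncomputable def kernelDiff (a y r : ℝ) : ℝ :=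
  r ^ (-a) - (r ^ 2 + y ^ 2) ^ (-a / 2)

theorem sq_rpow_neg_half {r : ℝ} (hr : 0 ≤ r) (a : ℝ) : (r ^ 2) ^ (-a / 2) = r ^ (-a) := by
  rw [← Real.rpow_natCast_mul hr]
  congr 1
  push_cast
  ring

theorem kernelDiff_nonneg {a r : ℝ} (ha : 0 ≤ a) (hr : 0 < r) (y : ℝ) :
    0 ≤ kernelDiff a y r := by
  rw [kernelDiff, sub_nonneg, ← sq_rpow_neg_half hr.le]
  exact Real.rpow_le_rpow_of_nonpos (by positivity) (by nlinarith [sq_nonneg y]) (by linarith)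

theorem kernelDiff_le_rpow (a y r : ℝ) : kernelDiff a y r ≤ r ^ (-a) :=
  sub_le_self _ (by positivity)

theorem one_sub_mul_le_one_add_rpow_neg {p s : ℝ} (hp : 0 ≤ p) (hs : 0 ≤ s) :
    1 - p * s ≤ (1 + s) ^ (-p) := by
  have hlog : Real.log (1 + s) ≤ s := by
    linarith [Real.log_le_sub_one_of_pos (show 0 < 1 + s by linarith)]
  rw [Real.rpow_def_of_pos (by linarith)]
  nlinarith [Real.add_one_le_exp (Real.log (1 + s) * -p), mul_le_mul_of_nonneg_left hlog hp]

theorem kernelDiff_one_le {a r : ℝ} (ha : 0 ≤ a) (hr : 0 < r) :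
    kernelDiff a 1 r ≤ a / 2 * r ^ (-a - 2) := by
  have hfac : r ^ 2 + 1 ^ 2 = r ^ 2 * (1 + (r ^ 2)⁻¹) := by field_simp
  have hpow : r ^ (-a - 2) = r ^ (-a) * (r ^ 2)⁻¹ := by
    rw [Real.rpow_sub hr, Real.rpow_two, div_eq_mul_inv]
  rw [kernelDiff, hfac, Real.mul_rpow (by positivity) (by positivity), sq_rpow_neg_half hr.le, hpow]
  have hb := one_sub_mul_le_one_add_rpow_neg (p := a / 2) (s := (r ^ 2)⁻¹) (by positivity)
    (by positivity)
  rw [← neg_div] at hb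
  nlinarith [mul_le_mul_of_nonneg_left hb (Real.rpow_nonneg hr.le (-a))]

theorem kernelDiff_mul {a y r : ℝ} (hy : 0 < y) (hr : 0 ≤ r) :
    kernelDiff a y (y * r) = y ^ (-a) * kernelDiff a 1 r := by
  have hfac : (y * r) ^ 2 + y ^ 2 = y ^ 2 * (r ^ 2 + 1 ^ 2) := by ring
  rw [kernelDiff, kernelDiff, hfac, Real.mul_rpow hy.le hr,
    Real.mul_rpow (by positivity) (by positivity), sq_rpow_neg_half hy.le]
  ring

theorem measurable_kernelDiff (a y : ℝ) : Measurable (kernelDiff a y) := by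
  unfold kernelDiff
  fun_prop

theorem continuousOn_kernelDiff (a y : ℝ) : ContinuousOn (kernelDiff a y) (Ioi 0) := by
  intro r hr
  have hr' : 0 < r := hr
  have hsq : r ^ 2 + y ^ 2 ≠ 0 := by positivity
  unfold kernelDiff
  exact ((continuousAt_id.rpow_const (Or.inl hr'.ne')).sub
    (((continuousAt_id.pow 2).add continuousAt_const).rpow_const (Or.inl hsq))).continuousWithinAt

theorem integrableOn_pow_mul_kernelDiff_one {N : ℕ} (hN : 1 ≤ N) {σ : ℝ} (hσ : σ ∈ Ioo (0 : ℝ) 2) :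
    IntegrableOn (fun r : ℝ => r ^ (N - 1) • (r ^ 2 * kernelDiff (N + σ) 1 r)) (Ioi 0) := by
  obtain ⟨hσ0, hσ2⟩ := hσ
  have ha : 0 ≤ (N : ℝ) + σ := by positivity
  have hpow : ∀ {r : ℝ}, 0 < r → ∀ b : ℝ, r ^ (N - 1) * (r ^ 2 * r ^ b) = r ^ (N + 1 + b) := by
    intro r hr b
    rw [← mul_assoc, ← pow_add, show N - 1 + 2 = N + 1 by lia, ← Real.rpow_natCast,
      ← Real.rpow_add hr]
    push_cast
    rfl
  have hmeas : Measurable fun r : ℝ => r ^ (N - 1) • (r ^ 2 * kernelDiff (N + σ) 1 r) := by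
    have := measurable_kernelDiff (N + σ) 1
    simp only [smul_eq_mul]
    fun_prop
  have hnorm : ∀ {r : ℝ}, 0 < r → ‖r ^ (N - 1) • (r ^ 2 * kernelDiff (N + σ) 1 r)‖ =
      r ^ (N - 1) * (r ^ 2 * kernelDiff (N + σ) 1 r) := by
    intro r hr
    have := kernelDiff_nonneg ha hr 1
    rw [smul_eq_mul, Real.norm_of_nonneg (by positivity)]
  rw [← Ioc_union_Ioi_eq_Ioi zero_le_one]
  refine IntegrableOn.union ?_ ?_
  · have hint : IntegrableOn (fun r : ℝ => r ^ (1 - σ)) (Ioc 0 1) :=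
      (intervalIntegrable_iff_integrableOn_Ioc_of_le zero_le_one).1
        (intervalIntegral.intervalIntegrable_rpow' (by linarith))
    refine hint.mono' hmeas.aestronglyMeasurable ?_
    filter_upwards [ae_restrict_mem measurableSet_Ioc] with r hr
    rw [hnorm hr.1, show 1 - σ = N + 1 + -(N + σ) by ring, ← hpow hr.1]
    have := hr.1
    gcongr
    exact kernelDiff_le_rpow _ _ _
  · have hint : IntegrableOn (fun r : ℝ => (N + σ) / 2 * r ^ (-1 - σ)) (Ioi 1) :=
      (integrableOn_Ioi_rpow_of_lt (by linarith) zero_lt_one).const_mul _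
    refine hint.mono' hmeas.aestronglyMeasurable ?_
    filter_upwards [ae_restrict_mem measurableSet_Ioi] with r hr
    have hr0 : 0 < r := zero_lt_one.trans hr
    rw [hnorm hr0, show -1 - σ = N + 1 + (-(N + σ) - 2) by ring, ← hpow hr0,
      mul_left_comm ((N + σ) / 2), mul_left_comm ((N + σ) / 2)]
    gcongr
    exact kernelDiff_one_le ha hr0

theorem integrable_sq_norm_mul_kernelDiff_one {N : ℕ} (hN : 1 ≤ N) {σ : ℝ}
    (hσ : σ ∈ Ioo (0 : ℝ) 2) :
    Integrable fun v : EuclideanSpace ℝ (Fin N) => ‖v‖ ^ 2 * kernelDiff (N + σ) 1 ‖v‖ := by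
  have : Nonempty (Fin N) := ⟨⟨0, hN⟩⟩
  refine (integrable_fun_norm_addHaar volume
    (f := fun r => r ^ 2 * kernelDiff (N + σ) 1 r)).2 ?_
  simpa using integrableOn_pow_mul_kernelDiff_one hN hσ

theorem sq_norm_mul_kernelDiff_smul {E : Type*} [NormedAddCommGroup E] [NormedSpace ℝ E]
    {y : ℝ} (hy : 0 < y) (a : ℝ) (v : E) :
    ‖y • v‖ ^ 2 * kernelDiff a y ‖y • v‖ =
      y ^ (2 - a) * (‖v‖ ^ 2 * kernelDiff a 1 ‖v‖) := by
  rw [norm_smul, Real.norm_of_nonneg hy.le, kernelDiff_mul hy (norm_nonneg v), sub_eq_add_neg,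
    Real.rpow_add hy, Real.rpow_two]
  ring

theorem integrable_sq_norm_mul_kernelDiff {N : ℕ} (hN : 1 ≤ N) {σ : ℝ}
    (hσ : σ ∈ Ioo (0 : ℝ) 2) {y : ℝ} (hy : 0 < y) :
    Integrable fun v : EuclideanSpace ℝ (Fin N) => ‖v‖ ^ 2 * kernelDiff (N + σ) y ‖v‖ := by
  rw [← integrable_comp_smul_iff volume _ hy.ne']
  simp only [sq_norm_mul_kernelDiff_smul hy]
  exact (integrable_sq_norm_mul_kernelDiff_one hN hσ).const_mul _

theorem integral_sq_norm_mul_kernelDiff (N : ℕ) (σ : ℝ) {y : ℝ} (hy : 0 < y) :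
    ∫ v : EuclideanSpace ℝ (Fin N), ‖v‖ ^ 2 * kernelDiff (N + σ) y ‖v‖ =
      y ^ (2 - σ) *
        ∫ v : EuclideanSpace ℝ (Fin N), ‖v‖ ^ 2 * kernelDiff (N + σ) 1 ‖v‖ := by
  have h := Measure.integral_comp_smul_of_nonneg
    (volume : Measure (EuclideanSpace ℝ (Fin N)))
    (fun v => ‖v‖ ^ 2 * kernelDiff (N + σ) y ‖v‖) y (hR := hy.le)
  simp only [sq_norm_mul_kernelDiff_smul hy, integral_const_mul, finrank_euclideanSpace_fin,
    smul_eq_mul] at h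
  have hyN : y ^ N ≠ 0 := by positivity
  rw [eq_inv_mul_iff_mul_eq₀ hyN] at h
  rw [← h, ← mul_assoc, ← Real.rpow_natCast, ← Real.rpow_add hy]
  congr 2
  ring

theorem abs_second_difference_le {E : Type*} [NormedAddCommGroup E] [NormedSpace ℝ E]
    {g : E → ℝ} (hg : ContDiff ℝ 2 g) {M : ℝ} (hM : ∀ z, ‖iteratedFDeriv ℝ 2 g z‖ ≤ M)
    (x v : E) :
    |g (x + v) + g (x - v) - 2 * g x| ≤ 2 * M * ‖v‖ ^ 2 := by
  have hg1 : Differentiable ℝ g := hg.differentiable (by norm_num)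
  have hg2 : Differentiable ℝ (fderiv ℝ g) :=
    (hg.fderiv_right (m := 1) (by norm_num)).differentiable (by norm_num)
  have hM0 : 0 ≤ M := (norm_nonneg _).trans (hM x)
  have hM2 : ∀ z, ‖fderiv ℝ (fderiv ℝ g) z‖ ≤ M := by
    intro z
    rw [← norm_iteratedFDeriv_zero (𝕜 := ℝ) (f := fderiv ℝ (fderiv ℝ g)),
      norm_iteratedFDeriv_fderiv, norm_iteratedFDeriv_fderiv]
    exact hM z
  have hlip : ∀ u w, ‖fderiv ℝ g u - fderiv ℝ g w‖ ≤ M * ‖u - w‖ := fun u w =>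
    convex_univ.norm_image_sub_le_of_norm_fderiv_le (fun z _ => hg2 z) (fun z _ => hM2 z)
      (mem_univ w) (mem_univ u)
  have hderiv : ∀ w, HasFDerivAt (fun w => g (x + w) + g (x - w))
      (fderiv ℝ g (x + w) - fderiv ℝ g (x - w)) w := by
    intro w
    have h1 := (hg1 (x + w)).hasFDerivAt.comp w ((hasFDerivAt_id w).const_add x)
    have h2 := (hg1 (x - w)).hasFDerivAt.comp w ((hasFDerivAt_id w).const_sub x)
    refine (h1.add h2).congr_fderiv ?_
    ext u
    simp [sub_eq_add_neg]
  have hbound : ∀ w ∈ Metric.closedBall (0 : E) ‖v‖,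
      ‖fderiv ℝ g (x + w) - fderiv ℝ g (x - w)‖ ≤ 2 * M * ‖v‖ := by
    intro w hw
    have hwv : ‖w‖ ≤ ‖v‖ := by simpa using hw
    calc _ ≤ M * ‖(x + w) - (x - w)‖ := hlip _ _
      _ = M * ‖(2 : ℝ) • w‖ := by rw [two_smul]; congr 2; abel
      _ = 2 * M * ‖w‖ := by rw [norm_smul]; norm_num; ring
      _ ≤ 2 * M * ‖v‖ := by gcongr
  have h := (convex_closedBall (0 : E) ‖v‖).norm_image_sub_le_of_norm_hasFDerivWithin_le
    (fun w _ => (hderiv w).hasFDerivWithinAt) hbound (x := 0) (y := v) (by simp) (by simp)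
  simp only [add_zero, sub_zero, Real.norm_eq_abs] at h
  rw [two_mul (g x), pow_two, ← mul_assoc]
  exact h

/-- In an integral over a symmetric set, a function may be replaced by its even part. -/
theorem setIntegral_eq_half_even {E : Type*} [NormedAddCommGroup E] [MeasurableSpace E]
    [BorelSpace E] {μ : Measure E} [μ.IsNegInvariant] {s : Set E} (hs : MeasurableSet s)
    (hneg : ∀ v, -v ∈ s ↔ v ∈ s) {f : E → ℝ} (hf : IntegrableOn f s μ) :
    ∫ v in s, f v ∂μ = ∫ v in s, (f v + f (-v)) / 2 ∂μ := by
  have hmem : Neg.neg ⁻¹' s = s := by ext v; simp [hneg]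
  have hmp : MeasurePreserving (Neg.neg : E → E) (μ.restrict s) (μ.restrict s) := by
    simpa only [hmem] using
      (Measure.measurePreserving_neg μ).restrict_preimage hs
  have hint : ∫ v in s, f (-v) ∂μ = ∫ v in s, f v ∂μ :=
    hmp.integral_comp (MeasurableEquiv.neg E).measurableEmbedding f
  have hfn : IntegrableOn (fun v => f (-v)) s μ := hmp.integrable_comp_of_integrable hf
  rw [integral_div, integral_add hf hfn, hint]
  ring

theorem integrableOn_annulus_sub_mul_kernelDiff {N : ℕ} {g : EuclideanSpace ℝ (Fin N) → ℝ}
    (hg : Continuous g) (x : EuclideanSpace ℝ (Fin N)) (a y R : ℝ) {ε : ℝ} (hε : 0 < ε) :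
    IntegrableOn (fun v => (g (x + v) - g x) * kernelDiff a y ‖v‖)
      {v : EuclideanSpace ℝ (Fin N) | ε < ‖v‖ ∧ ‖v‖ < R} := by
  have hcompact : IsCompact {v : EuclideanSpace ℝ (Fin N) | ε ≤ ‖v‖ ∧ ‖v‖ ≤ R} := by
    refine (isCompact_closedBall (0 : EuclideanSpace ℝ (Fin N)) R).of_isClosed_subset
      ((isClosed_le continuous_const continuous_norm).inter
        (isClosed_le continuous_norm continuous_const)) ?_
    intro v hv
    simpa using hv.2
  refine IntegrableOn.mono_set (ContinuousOn.integrableOn_compact' hcompact hcompact.measurableSet ?_)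
    (fun v (hv : ε < ‖v‖ ∧ ‖v‖ < R) => ⟨hv.1.le, hv.2.le⟩)
  refine ContinuousOn.mul (by fun_prop) ((continuousOn_kernelDiff a y).comp
    continuous_norm.continuousOn fun v hv => hε.trans_le hv.1)

/-- Near-field estimate `I_B`: for `g ∈ C²` with bounded second
derivative, the principal value of the integral of `(g ξ - g x)(K_0 - K_y)` over the
annulus `{ε < |ξ - x| < R}` exists as `ε → 0⁺` and is bounded by
`C (sup|D²g|) y^{2-σ}`, with `C` depending only on `N` and `σ`. -/
theorem stmt2 (N : ℕ) (hN : 1 ≤ N) (σ : ℝ) (hσ : σ ∈ Set.Ioo (0:ℝ) 2) :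
    ∃ C > 0, ∀ (g : EuclideanSpace ℝ (Fin N) → ℝ), ContDiff ℝ 2 g →
      ∀ M : ℝ, (∀ z, ‖iteratedFDeriv ℝ 2 g z‖ ≤ M) →
      ∀ (x : EuclideanSpace ℝ (Fin N)) (R y : ℝ), 0 < R → 0 < y →
        ∃ L : ℝ,
          Tendsto
            (fun ε : ℝ =>
              ∫ ξ in {ξ : EuclideanSpace ℝ (Fin N) | ε < dist ξ x ∧ dist ξ x < R},
                (g ξ - g x) *
                  (dist x ξ ^ (-((N : ℝ) + σ))
                    - (dist x ξ ^ 2 + y ^ 2) ^ (-((N : ℝ) + σ) / 2)))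
            (nhdsWithin 0 (Set.Ioi 0)) (nhds L)
          ∧ |L| ≤ C * M * y ^ (2 - σ) := by
  have ha : 0 ≤ (N : ℝ) + σ := add_nonneg N.cast_nonneg hσ.1.le
  set I := ∫ v : EuclideanSpace ℝ (Fin N), ‖v‖ ^ 2 * kernelDiff (N + σ) 1 ‖v‖
  have hK : ∀ (y : ℝ) (v : EuclideanSpace ℝ (Fin N)),
      0 ≤ ‖v‖ ^ 2 * kernelDiff (N + σ) y ‖v‖ := by
    intro y v
    rcases (norm_nonneg v).eq_or_lt with h | h
    · simp [← h]
    · exact mul_nonneg (sq_nonneg _) (kernelDiff_nonneg ha h y)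
  have hI0 : 0 ≤ I := integral_nonneg (hK 1)
  refine ⟨I + 1, by positivity, fun g hg M hM x R y hR hy => ?_⟩
  have hM0 : 0 ≤ M := (norm_nonneg _).trans (hM x)
  let A : ℝ → Set (EuclideanSpace ℝ (Fin N)) := fun ε => {v | ε < ‖v‖ ∧ ‖v‖ < R}
  have hA : ∀ ε, MeasurableSet (A ε) := fun ε =>
    (measurableSet_lt measurable_const measurable_norm).inter
      (measurableSet_lt measurable_norm measurable_const)
  let h : EuclideanSpace ℝ (Fin N) → ℝ := fun v =>
    (g (x + v) + g (x - v) - 2 * g x) / 2 * kernelDiff (N + σ) y ‖v‖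
  have hcongr : ∀ ε : ℝ, 0 < ε →
      ∫ ξ in {ξ : EuclideanSpace ℝ (Fin N) | ε < dist ξ x ∧ dist ξ x < R},
          (g ξ - g x) * (dist x ξ ^ (-((N : ℝ) + σ))
            - (dist x ξ ^ 2 + y ^ 2) ^ (-((N : ℝ) + σ) / 2)) =
        ∫ v, (A ε).indicator h v := by
    intro ε hε
    have hpre : (fun v => x + v) ⁻¹' {ξ | ε < dist ξ x ∧ dist ξ x < R} = A ε := by
      ext v
      simp [A]
    rw [← (measurePreserving_add_left volume x).setIntegral_preimage_emb
      (measurableEmbedding_addLeft x), hpre, integral_indicator (hA ε)]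
    simp only [dist_self_add_right]
    refine (setIntegral_eq_half_even (hA ε) (by simp [A])
      (integrableOn_annulus_sub_mul_kernelDiff hg.continuous x (N + σ) y R hε)).trans ?_
    congr 1 with v
    simp only [h, norm_neg, ← sub_eq_add_neg]
    ring
  have hle : ∀ v, ‖h v‖ ≤ M * (‖v‖ ^ 2 * kernelDiff (N + σ) y ‖v‖) := by
    intro v
    rcases (norm_nonneg v).eq_or_lt with hv | hv
    · have : v = 0 := norm_eq_zero.1 hv.symm
      simp [h, this, two_mul]
    have hk := kernelDiff_nonneg ha hv y
    have hd := abs_second_difference_le hg hM x v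
    rw [Real.norm_eq_abs, abs_mul, abs_of_nonneg hk, abs_div, abs_two, ← mul_assoc]
    gcongr
    linarith
  have hle_ind : ∀ ε v, ‖(A ε).indicator h v‖ ≤ M * (‖v‖ ^ 2 * kernelDiff (N + σ) y ‖v‖) :=
    fun ε v => (norm_indicator_le_norm_self h v).trans (hle v)
  have hint := (integrable_sq_norm_mul_kernelDiff hN hσ hy).const_mul M
  have hmeas : Measurable h := by
    have := measurable_kernelDiff (N + σ) y
    have := hg.continuous.measurable
    fun_prop
  refine ⟨∫ v, (A 0).indicator h v, ?_, ?_⟩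
  · refine Tendsto.congr' (eventually_mem_nhdsWithin.mono fun ε hε => (hcongr ε hε).symm) ?_
    refine tendsto_integral_filter_of_dominated_convergence _
      (Eventually.of_forall fun ε => (hmeas.indicator (hA ε)).aestronglyMeasurable)
      (Eventually.of_forall fun ε => Eventually.of_forall (hle_ind ε)) hint
      (Eventually.of_forall fun v => tendsto_const_nhds.congr' ?_)
    by_cases hv : 0 < ‖v‖
    · filter_upwards [nhdsWithin_le_nhds (Iio_mem_nhds hv)] with ε hε
      have hε' : ε < ‖v‖ := hε
      simp [indicator, A, norm_pos_iff.1 hv, hε']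
    · filter_upwards [self_mem_nhdsWithin] with ε hε
      have hv0 : v = 0 := by simpa using hv
      simp [indicator, A, hv0, (mem_Ioi.1 hε).le]
  · calc |∫ v, (A 0).indicator h v|
        ≤ ∫ v : EuclideanSpace ℝ (Fin N), M * (‖v‖ ^ 2 * kernelDiff (N + σ) y ‖v‖) :=
          norm_integral_le_of_norm_le hint (Eventually.of_forall (hle_ind 0))
      _ = I * M * y ^ (2 - σ) := by
          rw [integral_const_mul, integral_sq_norm_mul_kernelDiff N σ hy]
          ring
      _ ≤ (I + 1) * M * y ^ (2 - σ) := by gcongr; linarith
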